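/- arXiv:1910.12282 — 2 statements merged into one kernel-verified Lean document; each statement's English description precedes it below -/
import Mathlib

section
/- Let (Ω, F, P) be a probability space with a filtration (F_k)_{k∈ℕ}, let X be a measurable space, and let (x_k)_{k∈ℕ} be an X-valued (F_k)-adapted process. Let B : X → ℝ be a nonnegative measurable function such that each B(x_k) is integrable, let c ≥ 0 be a constant, and suppose that for every k, E[B(x_{k+1}) | F_k] ≤ B(x_k) + c almost surely. Let X_0 and X_1 be measurable subsets of X, let δ ∈ [0,1], and assume: (i) x_0 ∈ X_0 almost surely; (ii) B(x) ≤ δ for all x ∈ X_0; (iii) B(x) > 1 for all x ∈ X_1. Then for every N ≥ 1, P( ∃ k with 0 ≤ k < N such that x_k ∈ X_1 ) ≤ δ + c·N. -/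
open MeasureTheory

/-- s-reachability via a barrier certificate: if `B` is at most `δ` on the initial
set `X₀`, exceeds `1` on the unsafe set `X₁`, and has conditional drift at most `c`
along the adapted process `x`, then the probability of reaching `X₁` within the
horizon `N` is at most `δ + c * N`. -/
theorem barrier_reachability_bound
    {Ω : Type*} {m0 : MeasurableSpace Ω} {μ : Measure Ω} [IsProbabilityMeasure μ]
    (ℱ : Filtration ℕ m0)
    {X : Type*} [MeasurableSpace X] (x : ℕ → Ω → X)
    (hadapted : ∀ k, Measurable[ℱ k] (x k))
    (B : X → ℝ) (hBmeas : Measurable B) (hBnonneg : ∀ y, 0 ≤ B y)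
    (hint : ∀ k, Integrable (fun ω => B (x k ω)) μ)
    (c : ℝ) (hc : 0 ≤ c)
    (hdrift : ∀ k, μ[fun ω => B (x (k + 1) ω) | ℱ k] ≤ᵐ[μ] fun ω => B (x k ω) + c)
    (X₀ X₁ : Set X) (hX₀ : MeasurableSet X₀) (hX₁ : MeasurableSet X₁)
    (δ : ℝ) (hδ0 : 0 ≤ δ) (hδ1 : δ ≤ 1)
    (hinit : ∀ᵐ ω ∂μ, x 0 ω ∈ X₀)
    (hB₀ : ∀ y ∈ X₀, B y ≤ δ)
    (hB₁ : ∀ y ∈ X₁, 1 < B y) :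
    ∀ N : ℕ, 1 ≤ N →
      μ {ω | ∃ k, k < N ∧ x k ω ∈ X₁} ≤ ENNReal.ofReal (δ + c * N) := by
  set A : ℕ → Set Ω := fun n => {ω | ∃ k, k < n ∧ x k ω ∈ X₁} with hA
  -- hitting events are measurable at the right time
  have hAF : ∀ n, MeasurableSet[ℱ n] (A (n + 1)) := by
    intro n
    have : A (n + 1) = ⋃ k, ⋃ (_ : k < n + 1), x k ⁻¹' X₁ := by
      ext ω; simp [hA]
    rw [this]
    refine MeasurableSet.iUnion fun k => MeasurableSet.iUnion fun hk => ?_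
    exact ℱ.mono (Nat.lt_succ_iff.mp hk) _ (hadapted k hX₁)
  have hA0 : A 0 = ∅ := by ext ω; simp [hA]
  have hAm : ∀ n, MeasurableSet (A n) := by
    intro n
    cases n with
    | zero => rw [hA0]; exact MeasurableSet.empty
    | succ n => exact ℱ.le n _ (hAF n)
  have key : ∀ n : ℕ, μ.real (A n) + ∫ ω in (A n)ᶜ, B (x n ω) ∂μ ≤ δ + c * n := by
    intro n
    induction n with
    | zero =>
      rw [hA0]
      have h : ∫ ω, B (x 0 ω) ∂μ ≤ ∫ _, δ ∂μ := by
        refine integral_mono_ae (hint 0) (integrable_const δ) ?_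
        filter_upwards [hinit] with ω hω using hB₀ _ hω
      simpa using h
    | succ n ih =>
      have hDm : MeasurableSet (x n ⁻¹' X₁) := ℱ.le n _ (hadapted n hX₁)
      set D : Set Ω := (A n)ᶜ ∩ x n ⁻¹' X₁ with hD
      have hDm' : MeasurableSet D := (hAm n).compl.inter hDm
      have hsplit : (A n)ᶜ = (A (n + 1))ᶜ ∪ D := by
        ext ω
        simp only [hA, hD, Set.mem_compl_iff, Set.mem_setOf_eq, Set.mem_union, Set.mem_inter_iff,
          Set.mem_preimage]
        constructor
        · intro h
          by_cases hx : x n ω ∈ X₁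
          · exact Or.inr ⟨h, hx⟩
          · refine Or.inl ?_
            rintro ⟨k, hk, hkx⟩
            rcases Nat.lt_succ_iff_lt_or_eq.mp hk with h1 | h1
            · exact h ⟨k, h1, hkx⟩
            · exact hx (h1 ▸ hkx)
        · rintro (h | h)
          · rintro ⟨k, hk, hkx⟩
            exact h ⟨k, Nat.lt_succ_of_lt hk, hkx⟩
          · exact h.1
      have hdisj : Disjoint (A (n + 1))ᶜ D := by
        rw [Set.disjoint_left]
        intro ω h1 h2
        exact h1 ⟨n, Nat.lt_succ_self n, h2.2⟩
      have hAu : A (n + 1) ⊆ A n ∪ D := by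
        intro ω h
        by_contra hc'
        have h1 : ω ∈ (A n)ᶜ := fun h' => hc' (Or.inl h')
        rw [hsplit] at h1
        rcases h1 with h1 | h1
        · exact h1 h
        · exact hc' (Or.inr h1)
      have e1 : ∫ ω in (A n)ᶜ, B (x n ω) ∂μ
          = ∫ ω in (A (n + 1))ᶜ, B (x n ω) ∂μ + ∫ ω in D, B (x n ω) ∂μ := by
        rw [hsplit]
        exact setIntegral_union hdisj hDm' (hint n).integrableOn (hint n).integrableOn
      have e2 : μ.real D ≤ ∫ ω in D, B (x n ω) ∂μ := by
        have h : ∫ _ in D, (1 : ℝ) ∂μ ≤ ∫ ω in D, B (x n ω) ∂μ :=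
          setIntegral_mono_on (integrable_const (1 : ℝ)).integrableOn (hint n).integrableOn hDm'
            fun ω hω => (hB₁ _ hω.2).le
        simpa using h
      have e3 : μ.real (A (n + 1)) ≤ μ.real (A n) + μ.real D :=
        (measureReal_mono hAu).trans (measureReal_union_le _ _)
      have e4 : ∫ ω in (A (n + 1))ᶜ, B (x (n + 1) ω) ∂μ
          ≤ ∫ ω in (A (n + 1))ᶜ, B (x n ω) ∂μ + c := by
        rw [← setIntegral_condExp (ℱ.le n) (hint (n + 1)) (hAF n).compl]
        calc _ ≤ ∫ ω in (A (n + 1))ᶜ, (B (x n ω) + c) ∂μ :=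
              setIntegral_mono_ae integrable_condExp.integrableOn
                ((hint n).add (integrable_const c)).integrableOn (hdrift n)
          _ = ∫ ω in (A (n + 1))ᶜ, B (x n ω) ∂μ + μ.real (A (n + 1))ᶜ * c := by
              rw [integral_add (hint n).integrableOn (integrable_const c).integrableOn]
              simp
          _ ≤ _ := by
              have := mul_le_mul_of_nonneg_right
                (measureReal_le_one (μ := μ) (s := (A (n + 1))ᶜ)) hc
              linarith
      push_cast
      linarith
  intro N _
  have h1 := key N
  have h2 : 0 ≤ ∫ ω in (A N)ᶜ, B (x N ω) ∂μ := integral_nonneg fun ω => hBnonneg _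
  have h3 : μ.real (A N) ≤ δ + c * N := by linarith
  exact (ENNReal.le_ofReal_iff_toReal_le (measure_ne_top μ _) (by positivity)).2 h3
end

section
/- Let n, d, m ∈ ℕ. Work in the polynomial ring ℝ[x_1, …, x_n, u_1, …, u_d]. Let B, g_1, …, g_m, s_1, …, s_m, t_1, …, t_d be polynomials in the variables x_1, …, x_n only (viewed as elements of the larger ring), with each s_j a sum of squares, let G be a polynomial in all variables x_1, …, x_n, u_1, …, u_d, and let c ∈ ℝ. Suppose that the polynomial B − G + c − ∑_{i=1}^d (u_i − t_i) − ∑_{j=1}^m s_j · g_j is a sum of squares in ℝ[x_1, …, x_n, u_1, …, u_d]. Then for every x ∈ ℝ^n with g_j(x) ≥ 0 for all j = 1, …, m, evaluating u_i at t_i(x) gives G(x, t_1(x), …, t_d(x)) ≤ B(x) + c. -/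
open MvPolynomial

theorem sumsq_eval_nonneg {σ : Type*} {p : MvPolynomial σ ℝ} (h : IsSumSq p) (y : σ → ℝ) :
    0 ≤ eval y p := by
  induction h with
  | zero => simp
  | sq_add a _ ih =>
    rw [map_add, map_mul]
    exact add_nonneg (mul_self_nonneg _) ih

/-- Policy-extraction step of the sum-of-squares barrier-certificate synthesis:
if `B - G + c - ∑ i (u_i - t_i) - ∑ j s_j * g_j` is a sum of squares in
`ℝ[x₁,…,xₙ,u₁,…,u_d]`, with `B, g_j, s_j, t_i` polynomials in the `x`-variables
only and each `s_j` a sum of squares, then on `{x | ∀ j, 0 ≤ g_j(x)}`, substituting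
`u_i = t_i(x)` yields `G(x, t(x)) ≤ B(x) + c`. -/
theorem sos_policy_extraction
    (n d m : ℕ)
    (B : MvPolynomial (Fin n) ℝ)
    (g s : Fin m → MvPolynomial (Fin n) ℝ)
    (t : Fin d → MvPolynomial (Fin n) ℝ)
    (G : MvPolynomial (Fin n ⊕ Fin d) ℝ) (c : ℝ)
    (hs : ∀ j, IsSumSq (s j))
    (hsos : IsSumSq
      ((rename Sum.inl B) - G + C c
        - ∑ i : Fin d, (X (Sum.inr i) - rename Sum.inl (t i))
        - ∑ j : Fin m, (rename Sum.inl (s j)) * (rename Sum.inl (g j))))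
    (x : Fin n → ℝ) (hx : ∀ j, 0 ≤ eval x (g j)) :
    eval (Sum.elim x (fun i => eval x (t i))) G ≤ eval x B + c := by
  have h := sumsq_eval_nonneg hsos (Sum.elim x (fun i => eval x (t i)))
  have h2 : 0 ≤ ∑ j : Fin m, eval x (s j) * eval x (g j) :=
    Finset.sum_nonneg fun j _ => mul_nonneg (sumsq_eval_nonneg (hs j) x) (hx j)
  simp only [map_sub, map_add, map_sum, map_mul, eval_rename, eval_X, eval_C, Sum.elim_comp_inl,
    Sum.elim_inr, sub_self, Finset.sum_const_zero] at h
  linarith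
end
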